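/- (Equivariance of the duality map δ.) For every x ∈ {e_1, …, e_m, f_1, …, f_m} (regarded as elements of Cl(V) acting on V_Spin) and all w, u ∈ V_Spin one has δ(x·w)(u) + δ(w)(x·u) = 0; that is, δ intertwines the action on V_Spin with the dual (minus-transpose) action on V_Spin^*, so δ is an isomorphism of so(V)-representations V_Spin → V_Spin^*. -/

import Mathlib

/-!
Formalization of a statement from "A Landau-Ginzburg model for Lagrangian
Grassmannians, Langlands duality, and relations in quantum cohomology"
(arXiv:1304.4958).

Conventions: `V = ℂ^(2m+1)` with 0-based coordinates (`a : Fin (2m+1)`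
corresponds to the paper's 1-based basis index `i = a+1`);
`ε(i) = (−1)^(m+1−i)`, written as `(−1)^(m+1+i)` which has the same parity.
-/

noncomputable section
open scoped BigOperators

def eps (m i : ℕ) : ℂ := (-1 : ℂ) ^ (m + 1 + i)

/-- The spin representation `V_Spin = ⋀•W`, modelled by coordinates with respect to its
basis `{w_I}` indexed by the subsets `I ⊆ {1,…,m}` (encoded as `Finset (Fin m)`:
the element `a : Fin m` stands for the paper index `a+1`, i.e. the basis vector
`v_{a+1}` of `W`). -/
abbrev VS (m : ℕ) := Finset (Fin m) → ℂ

/-- The basis vector `w_I` of `V_Spin`. -/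
def wB {m : ℕ} (I : Finset (Fin m)) : VS m := fun L => if L = I then 1 else 0

/-- The action of `v_{a+1}` (for `a : Fin m`) on `V_Spin`, i.e. wedging with `v_{a+1}`:
`v_{a+1} ⋅ w_L = (−1)^{#{l ∈ L : l < a}} w_{L ∪ {a}}` if `a ∉ L`, and `0` otherwise. -/
def crtF (m : ℕ) (a : Fin m) : Module.End ℂ (VS m) :=
  Matrix.mulVecLin (Matrix.of fun L' L : Finset (Fin m) =>
    if a ∈ L' ∧ L = L'.erase a then (-1 : ℂ) ^ ((L'.filter (· < a)).card) else 0)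

/-- The action of `v̄_{a+1}` (for `a : Fin m`) on `V_Spin`: the interior product
(insertion operator) contracting with the linear form `2Φ(v̄_{a+1}, −)` on `W`. -/
def annF (m : ℕ) (a : Fin m) : Module.End ℂ (VS m) :=
  Matrix.mulVecLin (Matrix.of fun L' L : Finset (Fin m) =>
    if a ∈ L ∧ L' = L.erase a then
      (-1 : ℂ) ^ ((L.filter (· < a)).card) * eps m ((a : ℕ) + 1) else 0)

/-- The action of `v_{m+1}` on `V_Spin`: multiplication by `(−1)^k/√2` on `⋀^k W`. -/
def midF (m : ℕ) : Module.End ℂ (VS m) :=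
  Matrix.mulVecLin (Matrix.of fun L' L : Finset (Fin m) =>
    if L' = L then (-1 : ℂ) ^ (L.card) * (((Real.sqrt 2 : ℝ) : ℂ))⁻¹ else 0)

/-- The action on `V_Spin` of the Clifford generator `v_i`, for a paper index
`i ∈ {1,…,2m+1}`: wedging for `i ≤ m`, the scalar `(−1)^k/√2` for `i = m+1`, and
the insertion operator for `v̄_{2m+2−i}` when `i ≥ m+2`. -/
def genOpF (m : ℕ) (i : ℕ) : Module.End ℂ (VS m) :=
  if h : 1 ≤ i ∧ i ≤ m then crtF m ⟨i - 1, by omega⟩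
  else if i = m + 1 then midF m
  else if h2 : m + 2 ≤ i ∧ i ≤ 2 * m + 1 then annF m ⟨2 * m + 1 - i, by omega⟩
  else 0

/-- The action on `V_Spin` of `e_i = ε(i+1) v_i v̄_{i+1}` for `i ≤ m−1`
(resp. `e_m = √2 v_m v_{m+1}`); note `v̄_{i+1} = v_{2m+1−i}`. -/
def eEnd (m i : ℕ) : Module.End ℂ (VS m) :=
  if i = m then ((Real.sqrt 2 : ℝ) : ℂ) • (genOpF m m * genOpF m (m + 1))
  else eps m (i + 1) • (genOpF m i * genOpF m (2 * m + 1 - i))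

/-- The action on `V_Spin` of `f_i = ε(i) v_{i+1} v̄_i` for `i ≤ m−1`
(resp. `f_m = √2 v̄_m v_{m+1}`); note `v̄_i = v_{2m+2−i}` and `v̄_m = v_{m+2}`. -/
def fEnd (m i : ℕ) : Module.End ℂ (VS m) :=
  if i = m then ((Real.sqrt 2 : ℝ) : ℂ) • (genOpF m (m + 2) * genOpF m (m + 1))
  else eps m i • (genOpF m (i + 1) * genOpF m (2 * m + 2 - i))

/-- `|λ(I)| = Σ_{a ∈ I} (m − a)`: the weight of the strict partition whose index set is
`I` (the element `a : Fin m`, i.e. paper index `a+1 = m+1−p`, corresponds to the part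
`p = m−a`). -/
def psum (m : ℕ) (I : Finset (Fin m)) : ℕ := ∑ a ∈ I, (m - (a : ℕ))

/-- The dual basis vector `w*_K ∈ V_Spin^*`, the coordinate functional at `K`. -/
def wStar {m : ℕ} (K : Finset (Fin m)) : Module.Dual ℂ (VS m) := LinearMap.proj K

/-- The linear map `δ : V_Spin → V_Spin^*` determined by
`δ(w_λ) = (−1)^{|λ|} w*_{PD(λ)}`; Poincaré duality `PD` corresponds to complementation
of index subsets of `{1,…,m}`. -/
def deltaF (m : ℕ) : VS m →ₗ[ℂ] Module.Dual ℂ (VS m) where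
  toFun f := ∑ I : Finset (Fin m), ((-1 : ℂ) ^ (psum m I) * f I) • wStar Iᶜ
  map_add' f g := by simp [mul_add, add_smul, Finset.sum_add_distrib]
  map_smul' c f := by simp [Finset.smul_sum, smul_smul, mul_left_comm]

/-- The sign `(-1)^{#{l ∈ L : l < a}}` appearing in the action of `v_{a+1}` and `v̄_{a+1}`. -/
def sgnBelow {m : ℕ} (a : Fin m) (L : Finset (Fin m)) : ℂ :=
  (-1 : ℂ) ^ (L.filter (· < a)).card

lemma sgnBelow_mul_self {m : ℕ} (a : Fin m) (L : Finset (Fin m)) :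
    sgnBelow a L * sgnBelow a L = 1 := by
  rw [sgnBelow, ← mul_pow]
  simp

lemma eps_mul_self (m i : ℕ) : eps m i * eps m i = 1 := by
  rw [eps, ← mul_pow]
  simp

lemma sgnBelow_congr {m : ℕ} {a b : Fin m} {L K : Finset (Fin m)}
    (h : ∀ x, x ∈ L ∧ x < a ↔ x ∈ K ∧ x < b) : sgnBelow a L = sgnBelow b K := by
  have : L.filter (· < a) = K.filter (· < b) := by
    ext x
    simpa using h x
  rw [sgnBelow, sgnBelow, this]

lemma crtF_apply {m : ℕ} (a : Fin m) (f : VS m) (L : Finset (Fin m)) :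
    crtF m a f L = if a ∈ L then sgnBelow a L * f (L.erase a) else 0 := by
  by_cases h : a ∈ L <;> simp [crtF, Matrix.mulVec, dotProduct, h, sgnBelow]

lemma annF_apply {m : ℕ} (a : Fin m) (f : VS m) (L : Finset (Fin m)) :
    annF m a f L =
      if a ∉ L then sgnBelow a L * eps m ((a : ℕ) + 1) * f (insert a L) else 0 := by
  have key (K : Finset (Fin m)) : (a ∈ K ∧ L = K.erase a) ↔ (a ∉ L ∧ K = insert a L) := by
    constructor
    · rintro ⟨h, rfl⟩
      simp [h]
    · rintro ⟨h, rfl⟩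
      simp [h]
  by_cases h : a ∈ L
  · simp [annF, Matrix.mulVec, dotProduct, key, h]
  · have hs : sgnBelow a (insert a L) = sgnBelow a L := by
      refine sgnBelow_congr fun x => ?_
      rw [Finset.mem_insert]
      refine ⟨?_, fun hx => ⟨Or.inr hx.1, hx.2⟩⟩
      rintro ⟨rfl | hx, hlt⟩
      · exact absurd hlt (lt_irrefl _)
      · exact ⟨hx, hlt⟩
    rw [sgnBelow] at hs
    simp [annF, Matrix.mulVec, dotProduct, key, h, hs]

lemma midF_apply {m : ℕ} (f : VS m) (L : Finset (Fin m)) :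
    midF m f L = (-1 : ℂ) ^ L.card * ((Real.sqrt 2 : ℝ) : ℂ)⁻¹ * f L := by
  simp [midF, Matrix.mulVec, dotProduct]

lemma genOpF_eq_crtF {m : ℕ} (a : Fin m) {i : ℕ} (h : i = a + 1) : genOpF m i = crtF m a := by
  subst h
  have := a.isLt
  rw [genOpF, dif_pos (by omega)]
  rfl

lemma genOpF_eq_midF (m : ℕ) : genOpF m (m + 1) = midF m := by
  rw [genOpF, dif_neg (by omega), if_pos rfl]

lemma genOpF_eq_annF {m : ℕ} (a : Fin m) {i : ℕ} (h : i + a = 2 * m + 1) :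
    genOpF m i = annF m a := by
  have := a.isLt
  rw [genOpF, dif_neg (by omega), if_neg (by omega), dif_pos (by omega)]
  congr
  omega

lemma sqrt_two_mul_inv : ((Real.sqrt 2 : ℝ) : ℂ) * ((Real.sqrt 2 : ℝ) : ℂ)⁻¹ = 1 :=
  mul_inv_cancel₀ (by simp)

lemma symmDiff_singleton_of_mem {α : Type*} [DecidableEq α] {a : α} {L : Finset α}
    (h : a ∈ L) : symmDiff L {a} = L.erase a := by
  ext x
  by_cases hx : x = a <;> simp [Finset.mem_symmDiff, hx, h]

lemma symmDiff_singleton_of_notMem {α : Type*} [DecidableEq α] {a : α} {L : Finset α}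
    (h : a ∉ L) : symmDiff L {a} = insert a L := by
  ext x
  by_cases hx : x = a <;> simp [Finset.mem_symmDiff, hx, h]

lemma symmDiff_pair {α : Type*} [DecidableEq α] {a b : α} {L : Finset α}
    (ha : a ∈ L) (hb : b ∉ L) : symmDiff L {a, b} = insert b (L.erase a) := by
  ext x
  by_cases hx : x = a
  · subst hx
    have : x ≠ b := fun h => hb (h ▸ ha)
    simp [Finset.mem_symmDiff, ha, this]
  · by_cases hxb : x = b <;> simp [Finset.mem_symmDiff, hx, hxb, hb]

lemma psum_insert {m : ℕ} {a : Fin m} {L : Finset (Fin m)} (h : a ∉ L) :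
    psum m (insert a L) = m - a + psum m L :=
  Finset.sum_insert h

lemma psum_erase {m : ℕ} {a : Fin m} {L : Finset (Fin m)} (h : a ∈ L) :
    m - a + psum m (L.erase a) = psum m L :=
  Finset.add_sum_erase L (fun a : Fin m => m - (a : ℕ)) h

lemma neg_one_pow_eq_neg_of_eq_succ {p q : ℕ} (h : p = q + 1 ∨ q = p + 1) :
    (-1 : ℂ) ^ p = -(-1 : ℂ) ^ q := by
  rcases h with rfl | rfl <;> simp [pow_succ]

lemma deltaF_apply {m : ℕ} (f g : VS m) :
    deltaF m f g = ∑ I : Finset (Fin m), (-1 : ℂ) ^ psum m I * f I * g Iᶜ := by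
  simp [deltaF, wStar]

/-- An operator moving coordinates along a fixed symmetric difference, on a set of indices stable
under the induced twisted complementation, is skew for `δ` once the move changes the sign
`(-1)^{|λ|}`. -/
lemma deltaF_add_eq_zero_of_symmDiff {m : ℕ} {T : Module.End ℂ (VS m)} (S : Finset (Fin m))
    (P : Finset (Fin m) → Prop) [DecidablePred P]
    (hT : ∀ f L, T f L = if P L then f (symmDiff L S) else 0)
    (hP : ∀ L, P (symmDiff L S)ᶜ ↔ P L)
    (hs : ∀ L, P L → psum m L = psum m (symmDiff L S) + 1 ∨ psum m (symmDiff L S) = psum m L + 1)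
    (w u : VS m) : deltaF m (T w) u + deltaF m w (T u) = 0 := by
  have hinv : Function.Involutive fun L : Finset (Fin m) => symmDiff L S :=
    fun L => symmDiff_symmDiff_cancel_right S L
  have hc (L : Finset (Fin m)) : symmDiff (symmDiff L S)ᶜ S = Lᶜ := by
    ext x
    simp only [Finset.mem_symmDiff, Finset.mem_compl]
    tauto
  rw [deltaF_apply, deltaF_apply,
    ← hinv.bijective.sum_comp fun I => (-1 : ℂ) ^ psum m I * w I * T u Iᶜ,
    ← Finset.sum_add_distrib]
  refine Finset.sum_eq_zero fun I _ => ?_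
  simp only [hT, hP, hc]
  split_ifs with h
  · rw [neg_one_pow_eq_neg_of_eq_succ (hs I h)]
    ring
  · simp

lemma sgnBelow_last {m : ℕ} {a : Fin m} (ha : (a : ℕ) + 1 = m) (L : Finset (Fin m)) :
    sgnBelow a L = (-1 : ℂ) ^ (L.erase a).card := by
  have : L.filter (· < a) = L.erase a := by
    ext x
    have := x.isLt
    rw [Finset.mem_filter, Finset.mem_erase, ne_eq, Fin.ext_iff, Fin.lt_def, and_comm]
    exact and_congr_left fun _ => by omega
  rw [sgnBelow, this]

lemma eEnd_last_apply {m : ℕ} {a : Fin m} (ha : (a : ℕ) + 1 = m) (f : VS m)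
    (L : Finset (Fin m)) :
    eEnd m m f L = if a ∈ L then f (symmDiff L {a}) else 0 := by
  rw [eEnd, if_pos rfl, genOpF_eq_crtF a ha.symm, genOpF_eq_midF]
  simp only [LinearMap.smul_apply, Module.End.mul_apply, Pi.smul_apply, smul_eq_mul, crtF_apply,
    midF_apply]
  split_ifs with h
  · rw [symmDiff_singleton_of_mem h]
    have h1 := sgnBelow_mul_self a L
    rw [← sgnBelow_last ha]
    linear_combination (f (L.erase a)) * h1 +
      sgnBelow a L * sgnBelow a L * f (L.erase a) * sqrt_two_mul_inv
  · simp

lemma fEnd_last_apply {m : ℕ} {a : Fin m} (ha : (a : ℕ) + 1 = m) (f : VS m)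
    (L : Finset (Fin m)) :
    fEnd m m f L = if a ∉ L then f (symmDiff L {a}) else 0 := by
  rw [fEnd, if_pos rfl, genOpF_eq_annF a (by omega), genOpF_eq_midF]
  simp only [LinearMap.smul_apply, Module.End.mul_apply, Pi.smul_apply, smul_eq_mul, annF_apply,
    midF_apply]
  by_cases h : a ∈ L
  · simp [h]
  · rw [if_pos h, if_pos h, symmDiff_singleton_of_notMem h, Finset.card_insert_of_notMem h, pow_succ]
    have h1 := sgnBelow_mul_self a L
    have h2 : sgnBelow a L = (-1 : ℂ) ^ L.card := by
      rw [sgnBelow_last ha, Finset.erase_eq_of_notMem h]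
    have h3 : eps m (a + 1) = -1 := by
      rw [ha, eps, Odd.neg_one_pow ⟨m, by omega⟩]
    rw [← h2, h3]
    linear_combination (f (insert a L)) * h1 +
      sgnBelow a L * sgnBelow a L * f (insert a L) * sqrt_two_mul_inv

lemma eEnd_apply {m : ℕ} {a b : Fin m} (hab : (b : ℕ) = a + 1) (f : VS m)
    (L : Finset (Fin m)) :
    eEnd m b f L = if a ∈ L ∧ b ∉ L then f (symmDiff L {a, b}) else 0 := by
  have hb := b.isLt
  have hne : b ≠ a := fun h => by simp [h] at hab
  rw [eEnd, if_neg (by omega), genOpF_eq_crtF a hab, genOpF_eq_annF b (by omega)]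
  simp only [LinearMap.smul_apply, Module.End.mul_apply, Pi.smul_apply, smul_eq_mul, crtF_apply,
    annF_apply, Finset.mem_erase, hne, ne_eq, not_false_eq_true, true_and]
  by_cases ha : a ∈ L
  · by_cases hbL : b ∈ L
    · simp [ha, hbL]
    · have hs : sgnBelow b (L.erase a) = sgnBelow a L := by
        refine sgnBelow_congr fun x => ?_
        rw [Finset.mem_erase, and_comm (a := x ≠ a), and_assoc]
        refine and_congr_right fun _ => ?_
        rw [ne_eq, Fin.ext_iff, Fin.lt_def, Fin.lt_def]
        omega
      simp only [ha, hbL, not_false_eq_true, and_self, if_true, symmDiff_pair ha hbL, hs]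
      have h1 := sgnBelow_mul_self a L
      have h2 := eps_mul_self m (b + 1)
      linear_combination (f (insert b (L.erase a))) * h1 +
        sgnBelow a L * sgnBelow a L * f (insert b (L.erase a)) * h2
  · simp [ha]

lemma fEnd_apply {m : ℕ} {a b : Fin m} (hab : (b : ℕ) = a + 1) (f : VS m)
    (L : Finset (Fin m)) :
    fEnd m b f L = if b ∈ L ∧ a ∉ L then f (symmDiff L {b, a}) else 0 := by
  have hb := b.isLt
  have hne : a ≠ b := fun h => by simp [h] at hab
  rw [fEnd, if_neg (by omega), genOpF_eq_crtF b rfl, genOpF_eq_annF a (by omega)]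
  simp only [LinearMap.smul_apply, Module.End.mul_apply, Pi.smul_apply, smul_eq_mul, crtF_apply,
    annF_apply, Finset.mem_erase, hne, ne_eq, not_false_eq_true, true_and]
  by_cases hbL : b ∈ L
  · by_cases ha : a ∈ L
    · simp [ha, hbL]
    · have hs : sgnBelow a (L.erase b) = sgnBelow b L := by
        refine sgnBelow_congr fun x => ?_
        have hx : x ∈ L → (x : ℕ) ≠ a := fun h h' => ha (Fin.ext h' ▸ h)
        rw [Finset.mem_erase, and_comm (a := x ≠ b), and_assoc]
        refine and_congr_right fun hxL => ?_
        have := hx hxL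
        rw [ne_eq, Fin.ext_iff, Fin.lt_def, Fin.lt_def]
        omega
      simp only [ha, hbL, not_false_eq_true, and_self, if_true, symmDiff_pair hbL ha, hs, ← hab]
      have h1 := sgnBelow_mul_self b L
      have h2 := eps_mul_self m b
      linear_combination (f (insert a (L.erase b))) * h1 +
        sgnBelow b L * sgnBelow b L * f (insert a (L.erase b)) * h2
  · simp [hbL]

/-- equivariance of the duality map `δ`. For every
`x ∈ {e_1,…,e_m,f_1,…,f_m}` (regarded as elements of `Cl(V)` acting on `V_Spin`) and all
`w, u ∈ V_Spin` one has `δ(x·w)(u) + δ(w)(x·u) = 0`; that is, `δ` intertwines the action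
on `V_Spin` with the dual (minus-transpose) action on `V_Spin^*`, so `δ` is an
isomorphism of `so(V)`-representations `V_Spin → V_Spin^*`. -/
theorem delta_equivariance (m : ℕ) (hm : 2 ≤ m) (i : ℕ) (hi : 1 ≤ i) (him : i ≤ m)
    (w u : VS m) :
    deltaF m (eEnd m i w) u + deltaF m w (eEnd m i u) = 0 ∧
    deltaF m (fEnd m i w) u + deltaF m w (fEnd m i u) = 0 := by
  rcases him.eq_or_lt with rfl | hlt
  · obtain ⟨a, ha⟩ : ∃ a : Fin i, (a : ℕ) + 1 = i := ⟨⟨i - 1, by omega⟩, by simp; omega⟩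
    constructor
    · refine deltaF_add_eq_zero_of_symmDiff {a} (fun L => a ∈ L) (eEnd_last_apply ha)
        (by simp) (fun L hL => ?_) w u
      rw [symmDiff_singleton_of_mem hL]
      have := psum_erase hL
      omega
    · refine deltaF_add_eq_zero_of_symmDiff {a} (fun L => a ∉ L) (fEnd_last_apply ha)
        (by simp) (fun L hL => ?_) w u
      rw [symmDiff_singleton_of_notMem hL]
      have := psum_insert hL
      omega
  · obtain ⟨a, b, hab, rfl⟩ : ∃ a b : Fin m, (b : ℕ) = a + 1 ∧ (b : ℕ) = i :=
      ⟨⟨i - 1, by omega⟩, ⟨i, hlt⟩, by simp; omega, rfl⟩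
    constructor
    · refine deltaF_add_eq_zero_of_symmDiff {a, b} (fun L => a ∈ L ∧ b ∉ L) (eEnd_apply hab)
        (by simp) (fun L hL => ?_) w u
      rw [symmDiff_pair hL.1 hL.2]
      have h1 := psum_erase hL.1
      have h2 := psum_insert (L := L.erase a) fun h => hL.2 (Finset.mem_of_mem_erase h)
      omega
    · refine deltaF_add_eq_zero_of_symmDiff {b, a} (fun L => b ∈ L ∧ a ∉ L) (fEnd_apply hab)
        (by simp) (fun L hL => ?_) w u
      rw [symmDiff_pair hL.1 hL.2]
      have h1 := psum_erase hL.1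
      have h2 := psum_insert (L := L.erase b) fun h => hL.2 (Finset.mem_of_mem_erase h)
      omega

end
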